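/- arXiv:2209.14090 — 2 statements merged into one kernel-verified Lean document; each statement's English description precedes it below -/
import Mathlib

section
/- Let G be an abelian group and R a commutative ring graded by G. If m is a G-maximal ideal of R and q := m ∩ R₀, then q̃ = m, where q̃ := ⊕_{g∈G} {r ∈ R_g | r·R_{−g} ⊆ q}. Consequently the assignments m ↦ m ∩ R₀ and q ↦ q̃ are mutually inverse bijections between the set of G-maximal ideals of R and the set of maximal ideals of R₀. -/
/-- A homogeneous ideal `p ⊊ R` is `G`-prime if for all homogeneous `x, y ∈ R`
with `x * y ∈ p`, either `x ∈ p` or `y ∈ p`. -/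
def Ideal.IsGPrime {G : Type*} [AddCommGroup G] [DecidableEq G]
    {R : Type*} [CommRing R] (𝒜 : G → AddSubgroup R) [GradedRing 𝒜]
    (p : Ideal R) : Prop :=
  Ideal.IsHomogeneous 𝒜 p ∧ p ≠ ⊤ ∧
    ∀ ⦃x y : R⦄, SetLike.IsHomogeneousElem 𝒜 x → SetLike.IsHomogeneousElem 𝒜 y →
      x * y ∈ p → x ∈ p ∨ y ∈ p

/-- A `G`-maximal ideal of `R` is an ideal maximal among proper homogeneous ideals. -/
def Ideal.IsGMaximal {G : Type*} [AddCommGroup G] [DecidableEq G]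
    {R : Type*} [CommRing R] (𝒜 : G → AddSubgroup R) [GradedRing 𝒜]
    (m : Ideal R) : Prop :=
  Ideal.IsHomogeneous 𝒜 m ∧ m ≠ ⊤ ∧
    ∀ J : Ideal R, Ideal.IsHomogeneous 𝒜 J → J ≠ ⊤ → m ≤ J → m = J

/-- The degree-zero part `I ∩ R₀` of an ideal `I` of `R`, as an ideal of the
degree-zero subring `R₀`. -/
def Ideal.degZeroPart {G : Type*} [AddCommGroup G] [DecidableEq G]
    {R : Type*} [CommRing R] (𝒜 : G → AddSubgroup R) [GradedRing 𝒜]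
    (I : Ideal R) : Ideal ↥(SetLike.GradeZero.subring 𝒜) :=
  I.comap (SetLike.GradeZero.subring 𝒜).subtype

/-- The set `q̃ := ⊕_{g∈G} {r ∈ R_g | r·R_{−g} ⊆ q}`: an element `r` belongs to it
iff every homogeneous component `r_g` of `r` satisfies `r_g · R_{−g} ⊆ q`. -/
def Ideal.tildeSet {G : Type*} [AddCommGroup G] [DecidableEq G]
    {R : Type*} [CommRing R] (𝒜 : G → AddSubgroup R) [GradedRing 𝒜]
    (q : Ideal ↥(SetLike.GradeZero.subring 𝒜)) : Set R :=
  { r : R | ∀ g : G, ∀ s ∈ 𝒜 (-g),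
      ((DirectSum.decompose 𝒜 r g : R) * s) ∈
        (Subtype.val '' (q : Set ↥(SetLike.GradeZero.subring 𝒜))) }


/-!
STATEMENT 4: If `m` is a `G`-maximal ideal of `R` and `q := m ∩ R₀`, then `q̃ = m`.
Consequently `m ↦ m ∩ R₀` and `q ↦ q̃` are mutually inverse bijections between the
set of `G`-maximal ideals of `R` and the set of maximal ideals of `R₀`.
-/

namespace Ideal

section Tilde

variable {G : Type*} [AddCommGroup G] [DecidableEq G] {R : Type*} [CommRing R]
  (𝒜 : G → AddSubgroup R) [GradedRing 𝒜]

/-- The set `tildeSet 𝒜 q` as an ideal of `R`. -/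
def tilde (q : Ideal (SetLike.GradeZero.subring 𝒜)) : Ideal R where
  carrier := tildeSet 𝒜 q
  zero_mem' g s _ := ⟨0, q.zero_mem, by simp⟩
  add_mem' {a b} ha hb g s hs := by
    obtain ⟨x, hx, hxa⟩ := ha g s hs
    obtain ⟨y, hy, hyb⟩ := hb g s hs
    refine ⟨x + y, q.add_mem hx hy, ?_⟩
    simp [DirectSum.decompose_add, add_mul, hxa, hyb]
  smul_mem' c r hr g s hs := by
    induction c using DirectSum.Decomposition.inductionOn 𝒜 with
    | zero => exact ⟨0, q.zero_mem, by simp⟩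
    | @homogeneous h a =>
      have hg : g = h + (g - h) := by abel
      have key : (DirectSum.decompose 𝒜 ((a : R) * r) g : R) =
          a * (DirectSum.decompose 𝒜 r (g - h) : R) := by
        conv_lhs => rw [hg]
        exact DirectSum.coe_decompose_mul_add_of_left_mem 𝒜 a.2
      have has : (a : R) * s ∈ 𝒜 (-(g - h)) := by
        have := SetLike.mul_mem_graded a.2 hs
        rwa [show h + -g = -(g - h) by abel] at this
      obtain ⟨x, hx, hxr⟩ := hr (g - h) _ has
      exact ⟨x, hx, by rw [smul_eq_mul, key, hxr]; ring⟩
    | add a b ha hb =>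
      obtain ⟨x, hx, hxa⟩ := ha
      obtain ⟨y, hy, hyb⟩ := hb
      refine ⟨x + y, q.add_mem hx hy, ?_⟩
      rw [add_smul, DirectSum.decompose_add, DirectSum.add_apply, AddSubgroup.coe_add, add_mul,
        ← hxa, ← hyb, Subring.coe_add]

theorem coe_tilde (q : Ideal (SetLike.GradeZero.subring 𝒜)) :
    (tilde 𝒜 q : Set R) = tildeSet 𝒜 q := rfl

variable {𝒜}

theorem mem_tilde {q : Ideal (SetLike.GradeZero.subring 𝒜)} {r : R} :
    r ∈ tilde 𝒜 q ↔ ∀ g : G, ∀ s ∈ 𝒜 (-g), ∃ x ∈ q, (x : R) = DirectSum.decompose 𝒜 r g * s :=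
  Iff.rfl

theorem isHomogeneous_tilde (q : Ideal (SetLike.GradeZero.subring 𝒜)) :
    (tilde 𝒜 q).IsHomogeneous 𝒜 := by
  intro i r hr
  refine mem_tilde.2 fun g s hs => ?_
  by_cases h : i = g
  · subst h
    simpa using mem_tilde.1 hr i s hs
  · exact ⟨0, q.zero_mem, by
      rw [DirectSum.decompose_of_mem_ne 𝒜 (SetLike.coe_mem _) h]; simp⟩

theorem tilde_mono : Monotone (tilde 𝒜) := fun _ _ h _ hr g s hs =>
  let ⟨x, hx, e⟩ := hr g s hs
  ⟨x, h hx, e⟩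

theorem degZeroPart_mono : Monotone (degZeroPart 𝒜) := fun _ _ h => comap_mono h

theorem degZeroPart_ne_top {I : Ideal R} (hI : I ≠ ⊤) : degZeroPart 𝒜 I ≠ ⊤ :=
  comap_ne_top _ hI

theorem le_tilde_degZeroPart {I : Ideal R} (hI : I.IsHomogeneous 𝒜) :
    I ≤ tilde 𝒜 (degZeroPart 𝒜 I) := fun r hr => mem_tilde.2 fun g s hs => by
  have h : (DirectSum.decompose 𝒜 r g : R) * s ∈ 𝒜 0 := by
    simpa using SetLike.mul_mem_graded (DirectSum.decompose 𝒜 r g).2 hs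
  exact ⟨⟨_, h⟩, I.mul_mem_right s (hI g hr), rfl⟩

theorem degZeroPart_tilde (q : Ideal (SetLike.GradeZero.subring 𝒜)) :
    degZeroPart 𝒜 (tilde 𝒜 q) = q := by
  ext ⟨x, hx⟩
  change x ∈ tilde 𝒜 q ↔ _
  have hx' : x ∈ 𝒜 0 := hx
  constructor
  · intro h
    obtain ⟨y, hy, e⟩ := mem_tilde.1 h 0 1 (by simpa using SetLike.one_mem_graded 𝒜)
    rw [DirectSum.decompose_of_mem_same 𝒜 hx', mul_one] at e
    exact (Subtype.ext e : y = ⟨x, hx⟩) ▸ hy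
  · refine fun h => mem_tilde.2 fun g s hs => ?_
    by_cases hg : 0 = g
    · subst hg
      have hs' : s ∈ SetLike.GradeZero.subring 𝒜 := by
        rw [neg_zero] at hs
        exact hs
      exact ⟨⟨x, hx⟩ * ⟨s, hs'⟩, q.mul_mem_right _ h, by
        rw [DirectSum.decompose_of_mem_same 𝒜 hx']; rfl⟩
    · exact ⟨0, q.zero_mem, by rw [DirectSum.decompose_of_mem_ne 𝒜 hx' hg]; simp⟩

theorem tilde_ne_top {q : Ideal (SetLike.GradeZero.subring 𝒜)} (hq : q ≠ ⊤) :
    tilde 𝒜 q ≠ ⊤ := fun h => hq <| by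
  rw [← degZeroPart_tilde q, h]
  exact comap_top

theorem IsGMaximal.tilde_degZeroPart {m : Ideal R} (hm : m.IsGMaximal 𝒜) :
    tilde 𝒜 (degZeroPart 𝒜 m) = m :=
  (hm.2.2 _ (isHomogeneous_tilde _) (tilde_ne_top (degZeroPart_ne_top hm.2.1))
    (le_tilde_degZeroPart hm.1)).symm

theorem IsGMaximal.isMaximal_degZeroPart {m : Ideal R} (hm : m.IsGMaximal 𝒜) :
    (degZeroPart 𝒜 m).IsMaximal := by
  refine ⟨degZeroPart_ne_top hm.2.1, fun q hq => by_contra fun hq_top => hq.ne ?_⟩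
  rw [hm.2.2 _ (isHomogeneous_tilde q) (tilde_ne_top hq_top)
    ((le_tilde_degZeroPart hm.1).trans (tilde_mono hq.le)), degZeroPart_tilde]

theorem IsMaximal.isGMaximal_tilde {q : Ideal (SetLike.GradeZero.subring 𝒜)}
    (hq : q.IsMaximal) : (tilde 𝒜 q).IsGMaximal 𝒜 := by
  refine ⟨isHomogeneous_tilde q, tilde_ne_top hq.ne_top, fun J hJ hJ_top hle => ?_⟩
  have hqJ : q = degZeroPart 𝒜 J := hq.eq_of_le (degZeroPart_ne_top hJ_top) <| by
    simpa only [degZeroPart_tilde] using degZeroPart_mono (𝒜 := 𝒜) hle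
  exact hle.antisymm (hqJ ▸ le_tilde_degZeroPart hJ)

variable (𝒜) in
/-- Taking degree-zero parts is a bijection from `G`-maximal ideals of `R` to maximal ideals of
the degree-zero subring. -/
def gMaximalEquiv : {m : Ideal R // m.IsGMaximal 𝒜} ≃
    {q : Ideal (SetLike.GradeZero.subring 𝒜) // q.IsMaximal} where
  toFun m := ⟨degZeroPart 𝒜 m.1, m.2.isMaximal_degZeroPart⟩
  invFun q := ⟨tilde 𝒜 q.1, q.2.isGMaximal_tilde⟩
  left_inv m := Subtype.ext m.2.tilde_degZeroPart
  right_inv q := Subtype.ext (degZeroPart_tilde q.1)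

end Tilde

end Ideal

theorem tilde_degZeroPart_eq_self_and_bijection
    {G : Type*} [AddCommGroup G] [DecidableEq G]
    {R : Type*} [CommRing R] (𝒜 : G → AddSubgroup R) [GradedRing 𝒜] :
    (∀ m : Ideal R, m.IsGMaximal 𝒜 →
      ∀ I : Ideal R, (I : Set R) = Ideal.tildeSet 𝒜 (m.degZeroPart 𝒜) → I = m) ∧
    ∃ e : {m : Ideal R // m.IsGMaximal 𝒜} ≃
          {q : Ideal ↥(SetLike.GradeZero.subring 𝒜) // q.IsMaximal},
      (∀ m : {m : Ideal R // m.IsGMaximal 𝒜},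
        (e m).1 = Ideal.degZeroPart 𝒜 m.1) ∧
      (∀ q : {q : Ideal ↥(SetLike.GradeZero.subring 𝒜) // q.IsMaximal},
        (((e.symm q).1 : Ideal R) : Set R) = Ideal.tildeSet 𝒜 q.1) := by
  refine ⟨fun m hm I hI => ?_, Ideal.gMaximalEquiv 𝒜, fun _ => rfl, fun _ => rfl⟩
  rw [← Ideal.coe_tilde, hm.tilde_degZeroPart] at hI
  exact SetLike.coe_injective hI
end

section
/- Let π : T → U be a covering functor between idempotent-complete triangulated categories such that the image of π generates U (i.e., the smallest thick subcategory of U containing all objects πX, X ∈ T, is U itself), and let B be a full subcategory of U contained in the image of π. Then B is a tilting subcategory of U if and only if π⁻¹B is a tilting subcategory of T. -/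
open CategoryTheory CategoryTheory.Limits CategoryTheory.Pretriangulated
open ZeroObject DirectSum

section Defs

variable (C : Type*) [Category C] [Preadditive C] [HasZeroObject C]
  [HasShift C ℤ] [∀ n : ℤ, (shiftFunctor C n).Additive] [Pretriangulated C]

/-- A set of objects `P` of a (pre)triangulated category is *thick* if it is the
class of objects of a full triangulated subcategory closed under direct summands:
it is closed under isomorphisms, contains `0`, is closed under shifts, under
extensions (in distinguished triangles), and under direct summands (retracts). -/
def IsThickSet (P : Set C) : Prop :=
  (∀ ⦃X Y : C⦄, (X ≅ Y) → X ∈ P → Y ∈ P) ∧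
  ((0 : C) ∈ P) ∧
  (∀ (X : C) (n : ℤ), X ∈ P → (X⟦n⟧ : C) ∈ P) ∧
  (∀ T : Triangle C, (T ∈ distTriang C) → T.obj₁ ∈ P → T.obj₃ ∈ P → T.obj₂ ∈ P) ∧
  (∀ X Y : C, (∃ (i : X ⟶ Y) (r : Y ⟶ X), i ≫ r = 𝟙 X) → Y ∈ P → X ∈ P)

/-- A set of objects `S` *generates* the triangulated category `C` if the smallest
thick subcategory of `C` containing `S` is all of `C`. -/
def GeneratesTriang (S : Set C) : Prop :=
  ∀ P : Set C, IsThickSet C P → S ⊆ P → ∀ X : C, X ∈ P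

/-- A (full) subcategory `B` is *presilting* if `Hom(B, B′[i]) = 0` for all
`B, B′ ∈ B` and all integers `i > 0`. -/
def IsPresiltingSet (B : Set C) : Prop :=
  ∀ X ∈ B, ∀ Y ∈ B, ∀ i : ℤ, 0 < i → ∀ f : X ⟶ (Y⟦i⟧), f = 0

/-- A (full) subcategory `B` is *pretilting* if `Hom(B, B′[i]) = 0` for all
`B, B′ ∈ B` and all integers `i ≠ 0`. -/
def IsPretiltingSet (B : Set C) : Prop :=
  ∀ X ∈ B, ∀ Y ∈ B, ∀ i : ℤ, i ≠ 0 → ∀ f : X ⟶ (Y⟦i⟧), f = 0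

/-- `B` is silting if it is presilting and generates. -/
def IsSiltingSet (B : Set C) : Prop :=
  IsPresiltingSet C B ∧ GeneratesTriang C B

/-- `B` is tilting if it is pretilting and generates. -/
def IsTiltingSet (B : Set C) : Prop :=
  IsPretiltingSet C B ∧ GeneratesTriang C B

end Defs

section Covering

variable {T : Type*} [Category T] [Preadditive T]
  {U : Type*} [Category U] [Preadditive U]

/-- The canonical map `⊕_{Y′ : πY′ = πY} Hom_T(X, Y′) → Hom_U(πX, πY)` whose
components are given by applying `π` (and identifying `πY′` with `πY`). -/
noncomputable def coveringMapRight (F : T ⥤ U) [F.Additive] (X Y : T) :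
    (⨁ (Y' : {Y' : T // F.obj Y' = F.obj Y}), (X ⟶ (Y' : T))) →+
      (F.obj X ⟶ F.obj Y) := by
  classical
  exact DirectSum.toAddMonoid fun Y' =>
    { toFun := fun f => F.map f ≫ eqToHom Y'.2
      map_zero' := by simp
      map_add' := fun f g => by rw [F.map_add, Preadditive.add_comp] }

/-- The canonical map `⊕_{X′ : πX′ = πX} Hom_T(X′, Y) → Hom_U(πX, πY)` whose
components are given by applying `π` (and identifying `πX′` with `πX`). -/
noncomputable def coveringMapLeft (F : T ⥤ U) [F.Additive] (X Y : T) :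
    (⨁ (X' : {X' : T // F.obj X' = F.obj X}), ((X' : T) ⟶ Y)) →+
      (F.obj X ⟶ F.obj Y) := by
  classical
  exact DirectSum.toAddMonoid fun X' =>
    { toFun := fun f => eqToHom X'.2.symm ≫ F.map f
      map_zero' := by simp
      map_add' := fun f g => by rw [F.map_add, Preadditive.comp_add] }

/-- An additive functor `π : T → U` is a *covering functor* if for all objects
`X, Y` of `T` the two canonical maps
`⊕_{Y′ : πY′=πY} Hom_T(X,Y′) → Hom_U(πX,πY)` and
`⊕_{X′ : πX′=πX} Hom_T(X′,Y) → Hom_U(πX,πY)` are bijective. -/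
def IsCoveringFunctor (F : T ⥤ U) [F.Additive] : Prop :=
  (∀ X Y : T, Function.Bijective (coveringMapRight F X Y)) ∧
  (∀ X Y : T, Function.Bijective (coveringMapLeft F X Y))

end Covering

/-!
STATEMENT 11: Let `π : T → U` be a covering functor between idempotent-complete
triangulated categories such that the image of `π` generates `U`, and let `B` be a
full subcategory of `U` contained in the image of `π`. Then `B` is a tilting
subcategory of `U` if and only if `π⁻¹B` is a tilting subcategory of `T`.
-/

section CoveringLemmas

variable {T : Type*} [Category T] [Preadditive T] {U : Type*} [Category U] [Preadditive U]
  {F : T ⥤ U} [F.Additive]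

lemma coveringMapRight_of {X Y : T} [DecidableEq {Y' : T // F.obj Y' = F.obj Y}]
    (Y' : {Y' : T // F.obj Y' = F.obj Y}) (f : X ⟶ Y') :
    coveringMapRight F X Y (DirectSum.of (fun Y' : {Y' : T // F.obj Y' = F.obj Y} ↦ (X ⟶ (Y' : T)))
      Y' f) = F.map f ≫ eqToHom Y'.2 := by
  classical
  unfold coveringMapRight
  convert DirectSum.toAddMonoid_of _ _ _
  rfl

namespace IsCoveringFunctor

lemma hom_induction (hcov : IsCoveringFunctor F) {X Y : T} {p : (F.obj X ⟶ F.obj Y) → Prop}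
    (zero : p 0) (add : ∀ f g, p f → p g → p (f + g))
    (map : ∀ (Y' : T) (h : F.obj Y' = F.obj Y) (f : X ⟶ Y'), p (F.map f ≫ eqToHom h))
    (f : F.obj X ⟶ F.obj Y) : p f := by
  classical
  obtain ⟨x, rfl⟩ := (hcov.1 X Y).2 f
  induction x using DirectSum.induction_on with
  | zero => simpa using zero
  | of Y' f => rw [coveringMapRight_of]; exact map Y'.1 Y'.2 f
  | add x y hx hy => simpa using add _ _ hx hy

/-- The component in `X ⟶ Y` of a morphism `F.obj X ⟶ F.obj Y`. -/
noncomputable def component (hcov : IsCoveringFunctor F) (X Y : T) :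
    (F.obj X ⟶ F.obj Y) →+ (X ⟶ Y) :=
  (DFinsupp.evalAddMonoidHom (β := fun Y' : {Y' : T // F.obj Y' = F.obj Y} ↦ (X ⟶ (Y' : T)))
    ⟨Y, rfl⟩).comp (AddEquiv.ofBijective (coveringMapRight F X Y) (hcov.1 X Y)).symm.toAddMonoidHom

lemma component_coveringMapRight (hcov : IsCoveringFunctor F) {X Y : T}
    (x : ⨁ (Y' : {Y' : T // F.obj Y' = F.obj Y}), (X ⟶ (Y' : T))) :
    hcov.component X Y (coveringMapRight F X Y x) = x ⟨Y, rfl⟩ :=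
  congr_fun (congr_arg DFunLike.coe
    ((AddEquiv.ofBijective (coveringMapRight F X Y) (hcov.1 X Y)).symm_apply_apply x)) _

lemma component_map (hcov : IsCoveringFunctor F) {X Y : T} (f : X ⟶ Y) :
    hcov.component X Y (F.map f) = f := by
  classical
  have := hcov.component_coveringMapRight (DirectSum.of
    (fun Y' : {Y' : T // F.obj Y' = F.obj Y} ↦ (X ⟶ (Y' : T))) ⟨Y, rfl⟩ f)
  rw [coveringMapRight_of, DirectSum.of_eq_same] at this
  simpa using this

lemma component_map_of_ne (hcov : IsCoveringFunctor F) {X Y Y' : T} (h : F.obj Y' = F.obj Y)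
    (hne : Y' ≠ Y) (f : X ⟶ Y') :
    hcov.component X Y (F.map f ≫ eqToHom h) = 0 := by
  classical
  have := hcov.component_coveringMapRight (DirectSum.of
    (fun Y' : {Y' : T // F.obj Y' = F.obj Y} ↦ (X ⟶ (Y' : T))) ⟨Y', h⟩ f)
  rwa [coveringMapRight_of, DirectSum.of_eq_of_ne _ _ _ (by simpa using hne.symm)] at this

lemma component_map_comp (hcov : IsCoveringFunctor F) {X X' Y : T} (a : X ⟶ X')
    (f : F.obj X' ⟶ F.obj Y) :
    hcov.component X Y (F.map a ≫ f) = a ≫ hcov.component X' Y f := by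
  induction f using hcov.hom_induction with
  | zero => simp
  | add f g hf hg => simp [hf, hg]
  | map Y' h f =>
    rw [← F.map_comp_assoc]
    by_cases hY : Y' = Y
    · subst hY
      rw [eqToHom_refl, Category.comp_id, Category.comp_id, component_map, component_map]
    · rw [component_map_of_ne _ _ hY, component_map_of_ne _ _ hY, comp_zero]

lemma map_injective (hcov : IsCoveringFunctor F) {X Y : T} {f g : X ⟶ Y}
    (h : F.map f = F.map g) : f = g := by
  rw [← hcov.component_map f, h, component_map]

/-- If `F.obj Z` is a retract of `F.obj Y`, then `𝟙 Z` is a sum of endomorphisms which factor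
through objects having the same image as `Y`. -/
lemma id_induction (hcov : IsCoveringFunctor F) {Y Z : T} (i : F.obj Z ⟶ F.obj Y)
    (r : F.obj Y ⟶ F.obj Z) (hir : i ≫ r = 𝟙 _) {p : (Z ⟶ Z) → Prop}
    (zero : p 0) (add : ∀ f g, p f → p g → p (f + g))
    (comp : ∀ (Y' : T) (_ : F.obj Y' = F.obj Y) (a : Z ⟶ Y') (b : Y' ⟶ Z), p (a ≫ b)) :
    p (𝟙 Z) := by
  have key : p (hcov.component Z Z (i ≫ r)) := by
    clear hir
    induction i using hcov.hom_induction with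
    | zero => simpa using zero
    | add f g hf hg => simpa using add _ _ hf hg
    | map Y' h f =>
      rw [Category.assoc, component_map_comp]
      exact comp Y' h _ _
  rwa [hir, ← F.map_id, component_map] at key

lemma shift_id_induction [HasShift T ℤ] [HasShift U ℤ] [F.CommShift ℤ]
    (hcov : IsCoveringFunctor F) {Y Y' : T} {n : ℤ} (h : F.obj Y' = F.obj (Y⟦n⟧))
    {p : (Y'⟦-n⟧ ⟶ Y'⟦-n⟧) → Prop}
    (zero : p 0) (add : ∀ f g, p f → p g → p (f + g))
    (comp : ∀ (Y'' : T) (_ : F.obj Y'' = F.obj Y) (a : Y'⟦-n⟧ ⟶ Y'') (b : Y'' ⟶ Y'⟦-n⟧),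
      p (a ≫ b)) :
    p (𝟙 _) := by
  let e : F.obj (Y'⟦-n⟧) ≅ F.obj Y :=
    (F.commShiftIso (-n)).app Y' ≪≫ (shiftFunctor U (-n)).mapIso (eqToIso h) ≪≫
      ((F.commShiftIso (-n)).app (Y⟦n⟧)).symm ≪≫
      F.mapIso ((shiftFunctorCompIsoId T n (-n) (by simp)).app Y)
  exact hcov.id_induction e.hom e.inv e.hom_inv_id zero add comp

end IsCoveringFunctor

end CoveringLemmas

section Thick

variable {C : Type*} [Category C] {P : Set C}

/-- The morphisms which factor through an object of `P`. -/
def FactorsThroughSet (P : Set C) {X Y : C} (f : X ⟶ Y) : Prop :=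
  ∃ D ∈ P, ∃ (a : X ⟶ D) (b : D ⟶ Y), f = a ≫ b

/-- The morphisms `s` which can be cancelled on the left modulo the ideal of morphisms factoring
through `P`. For thick `P` these include the morphisms whose cone is in `P`, and, unlike the
latter, they compose without the octahedral axiom. -/
def IsEpiModulo (P : Set C) {X Y : C} (s : X ⟶ Y) : Prop :=
  ∀ ⦃Z : C⦄ (g : Y ⟶ Z), FactorsThroughSet P (s ≫ g) → FactorsThroughSet P g

namespace IsEpiModulo

lemma id (X : C) : IsEpiModulo P (𝟙 X) := fun Z g hg ↦ by simpa using hg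

lemma comp {X Y Z : C} {s : X ⟶ Y} {t : Y ⟶ Z} (hs : IsEpiModulo P s) (ht : IsEpiModulo P t) :
    IsEpiModulo P (s ≫ t) := fun W g hg ↦ ht _ (hs _ (by simpa using hg))

end IsEpiModulo

variable [Preadditive C] [HasZeroObject C] [HasShift C ℤ]
  [∀ n : ℤ, (shiftFunctor C n).Additive] [Pretriangulated C]

namespace IsThickSet

lemma biprod_mem (hP : IsThickSet C P) {X Y : C} (hX : X ∈ P) (hY : Y ∈ P) : (X ⊞ Y) ∈ P :=
  hP.2.2.2.1 _ (binaryBiproductTriangle_distinguished X Y) hX hY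

lemma factorsThroughSet_zero (hP : IsThickSet C P) (X Y : C) :
    FactorsThroughSet P (0 : X ⟶ Y) :=
  ⟨0, hP.2.1, 0, 0, by simp⟩

lemma factorsThroughSet_add (hP : IsThickSet C P) {X Y : C} {f g : X ⟶ Y}
    (hf : FactorsThroughSet P f) (hg : FactorsThroughSet P g) : FactorsThroughSet P (f + g) := by
  obtain ⟨D, hD, a, b, rfl⟩ := hf
  obtain ⟨E, hE, c, d, rfl⟩ := hg
  exact ⟨D ⊞ E, hP.biprod_mem hD hE, biprod.lift a c, biprod.desc b d, by simp⟩

lemma mem_of_factorsThroughSet_id (hP : IsThickSet C P) {X : C}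
    (h : FactorsThroughSet P (𝟙 X)) : X ∈ P := by
  obtain ⟨D, hD, a, b, hab⟩ := h
  exact hP.2.2.2.2 X D ⟨a, b, hab.symm⟩ hD

end IsThickSet

namespace IsEpiModulo

lemma of_distinguished (hP : IsThickSet C P) {A : Triangle C} (hA : A ∈ distTriang C)
    (h : A.obj₁ ∈ P) : IsEpiModulo P A.mor₂ := by
  rintro X g ⟨D, hD, a, b, hab⟩
  obtain ⟨E, q, w, hE⟩ := distinguished_cocone_triangle (A.mor₁ ≫ a)
  obtain ⟨c, hc⟩ : ∃ c : A.obj₃ ⟶ E, A.mor₂ ≫ c = a ≫ q := by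
    obtain ⟨c, hc, -⟩ := complete_distinguished_triangle_morphism A _ hA hE (𝟙 _) a
      (Category.id_comp _).symm
    exact ⟨c, hc⟩
  obtain ⟨d, hd⟩ : ∃ d : E ⟶ X, b = q ≫ d := by
    refine Triangle.yoneda_exact₂ _ hE b ?_
    change (A.mor₁ ≫ a) ≫ b = 0
    rw [Category.assoc, ← hab, comp_distTriang_mor_zero₁₂_assoc _ hA, zero_comp]
  obtain ⟨t, ht⟩ := Triangle.yoneda_exact₃ _ hA (g - c ≫ d) (by
    rw [Preadditive.comp_sub, hab, reassoc_of% hc, ← hd, sub_self])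
  have hEP : E ∈ P := hP.2.2.2.1 _ (rot_of_distTriang _ hE) hD (hP.2.2.1 _ 1 h)
  rw [← sub_add_cancel g (c ≫ d)]
  exact hP.factorsThroughSet_add ⟨_, hP.2.2.1 _ 1 h, _, _, ht⟩ ⟨_, hEP, _, _, rfl⟩

lemma exists_comp_eq_zero (hP : IsThickSet C P) {X D : C} (hD : D ∈ P) (f : X ⟶ D) :
    ∃ (X' : C) (s : X' ⟶ X), IsEpiModulo P s ∧ s ≫ f = 0 := by
  obtain ⟨X', s, h, hs⟩ := distinguished_cocone_triangle₁ f
  exact ⟨X', s, of_distinguished hP (inv_rot_of_distTriang _ hs) (hP.2.2.1 _ _ hD),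
    comp_distTriang_mor_zero₁₂ _ hs⟩

end IsEpiModulo

end Thick

section Tilting

variable {T : Type*} [Category T] {U : Type*} [Category U] [Preadditive U] [HasShift U ℤ]
  {F : T ⥤ U}

/-- The objects `V` such that every morphism from the image of `F` to a shift of `V` is killed by
the image of a morphism which is an epimorphism modulo `P`. -/
def effaceableSet (F : T ⥤ U) (P : Set T) : Set U :=
  {V | ∀ (n : ℤ) ⦃Z : T⦄ (f : F.obj Z ⟶ V⟦n⟧),
    ∃ (Z' : T) (s : Z' ⟶ Z), IsEpiModulo P s ∧ F.map s ≫ f = 0}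

lemma effaceableSet_of_retract {P : Set T} {V W : U} (i : V ⟶ W) (r : W ⟶ V) (hir : i ≫ r = 𝟙 V)
    (hW : W ∈ effaceableSet F P) : V ∈ effaceableSet F P := by
  intro n Z f
  obtain ⟨Z', s, hs, h⟩ := hW n (f ≫ i⟦n⟧')
  refine ⟨Z', s, hs, ?_⟩
  have := h =≫ r⟦n⟧'
  simpa [← Functor.map_comp, hir] using this

lemma isThickSet_effaceableSet [HasZeroObject U]
    [∀ n : ℤ, (shiftFunctor U n).Additive] [Pretriangulated U] (F : T ⥤ U) (P : Set T) :
    IsThickSet U (effaceableSet F P) := by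
  refine ⟨fun X Y e hX ↦ effaceableSet_of_retract e.inv e.hom (by simp) hX, ?_, ?_, ?_,
    fun X Y ⟨i, r, h⟩ hY ↦ effaceableSet_of_retract i r h hY⟩
  · intro n Z f
    exact ⟨Z, 𝟙 Z, .id Z, ((shiftFunctor U n).map_isZero (isZero_zero U)).eq_of_tgt _ _⟩
  · intro X m hX n Z f
    obtain ⟨Z', s, hs, h⟩ := hX (m + n) (f ≫ (shiftAdd X m n).inv)
    refine ⟨Z', s, hs, ?_⟩
    rw [← cancel_mono (shiftAdd X m n).inv]
    simpa using h
  · intro A hA h₁ h₃ n Z f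
    obtain ⟨Z', s, hs, h⟩ := h₃ n (f ≫ A.mor₂⟦n⟧')
    obtain ⟨g, hg⟩ : ∃ g : F.obj Z' ⟶ A.obj₁⟦n⟧,
        F.map s ≫ f = g ≫ (n.negOnePow • A.mor₁⟦n⟧') := by
      refine Triangle.coyoneda_exact₂ _ (Triangle.shift_distinguished A hA n) (F.map s ≫ f) ?_
      change (F.map s ≫ f) ≫ (n.negOnePow • A.mor₂⟦n⟧') = 0
      rw [Linear.comp_units_smul, Category.assoc, h, smul_zero]
    obtain ⟨Z'', t, ht, h'⟩ := h₁ n g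
    refine ⟨Z'', t ≫ s, ht.comp hs, ?_⟩
    rw [F.map_comp, Category.assoc, hg, reassoc_of% h', zero_comp]

variable [Preadditive T] [HasShift T ℤ]

namespace IsCoveringFunctor

variable [F.Additive] [F.CommShift ℤ]

lemma isPretiltingSet_preimage (hcov : IsCoveringFunctor F) {B : Set U}
    (hB : IsPretiltingSet U B) : IsPretiltingSet T (F.obj ⁻¹' B) := by
  intro X hX Y hY n hn f
  apply hcov.map_injective
  rw [F.map_zero, ← cancel_mono ((F.commShiftIso n).hom.app Y), zero_comp]
  exact hB _ hX _ hY n hn _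

variable [∀ n : ℤ, (shiftFunctor T n).Additive]

lemma isPretiltingSet_of_preimage (hcov : IsCoveringFunctor F) {B : Set U}
    (hB : B ⊆ Set.range F.obj) (h : IsPretiltingSet T (F.obj ⁻¹' B)) : IsPretiltingSet U B := by
  intro V hV W hW n hn g
  obtain ⟨X, rfl⟩ := hB hV
  obtain ⟨Y, rfl⟩ := hB hW
  have hom_eq_zero (Y' : T) (hY' : F.obj Y' = F.obj (Y⟦n⟧)) (f : X ⟶ Y') : f = 0 := by
    let e := (shiftFunctorCompIsoId T (-n) n (by simp)).app Y'
    have : (f ≫ e.inv) ≫ (𝟙 (Y'⟦-n⟧))⟦n⟧' = 0 := by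
      refine hcov.shift_id_induction (p := fun u ↦ (f ≫ e.inv) ≫ u⟦n⟧' = 0) hY' ?_ ?_ ?_
      · simp
      · intro u v hu hv
        rw [Functor.map_add, Preadditive.comp_add, hu, hv, add_zero]
      · intro Y'' hY'' a b
        rw [Functor.map_comp, ← Category.assoc,
          h X hV Y'' (by simpa [hY''] using hW) n hn ((f ≫ e.inv) ≫ a⟦n⟧'), zero_comp]
    rw [← cancel_mono e.inv, zero_comp]
    simpa using this
  rw [← cancel_mono ((F.commShiftIso n).inv.app Y), zero_comp]
  induction g ≫ (F.commShiftIso n).inv.app Y using hcov.hom_induction with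
  | zero => rfl
  | add f g hf hg => exact (congr_arg₂ (· + ·) hf hg).trans (add_zero 0)
  | map Y' h' f => simp [hom_eq_zero Y' h' f]

variable [HasZeroObject T] [Pretriangulated T]

lemma effaceable_of_mem (hcov : IsCoveringFunctor F) {P : Set T} (hP : IsThickSet T P) {Y : T}
    (h : ∀ Y' : T, F.obj Y' = F.obj Y → Y' ∈ P) : F.obj Y ∈ effaceableSet F P := by
  have shift_mem (n : ℤ) (Y' : T) (hY' : F.obj Y' = F.obj (Y⟦n⟧)) : Y' ∈ P := by
    have : Y'⟦-n⟧ ∈ P := hP.mem_of_factorsThroughSet_id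
      (hcov.shift_id_induction hY' (hP.factorsThroughSet_zero _ _)
        (fun _ _ ↦ hP.factorsThroughSet_add) (fun Y'' h'' a b ↦ ⟨Y'', h _ h'', a, b, rfl⟩))
    exact hP.1 ((shiftFunctorCompIsoId T (-n) n (by simp)).app Y') (hP.2.2.1 _ n this)
  have key (n : ℤ) (Z : T) (f : F.obj Z ⟶ F.obj (Y⟦n⟧)) : ∀ (W : T) (t : W ⟶ Z),
      ∃ (W' : T) (s : W' ⟶ W), IsEpiModulo P s ∧ F.map (s ≫ t) ≫ f = 0 := by
    induction f using hcov.hom_induction with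
    | zero => exact fun W t ↦ ⟨W, 𝟙 W, .id W, by simp⟩
    | add f g hf hg =>
      intro W t
      obtain ⟨W', s, hs, hsf⟩ := hf W t
      obtain ⟨W'', s', hs', hsg⟩ := hg W' (s ≫ t)
      refine ⟨W'', s' ≫ s, hs'.comp hs, ?_⟩
      rw [Preadditive.comp_add, Category.assoc, hsg, F.map_comp, Category.assoc, hsf]
      simp
    | map Y' h' f =>
      intro W t
      obtain ⟨W', s, hs, h⟩ := IsEpiModulo.exists_comp_eq_zero hP (shift_mem n Y' h') (t ≫ f)
      refine ⟨W', s, hs, ?_⟩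
      rw [← F.map_comp_assoc, Category.assoc, h]
      simp
  intro n Z f
  obtain ⟨Z', s, hs, h⟩ := key n Z (f ≫ ((F.commShiftIso n).app Y).inv) Z (𝟙 Z)
  refine ⟨Z', s, hs, ?_⟩
  rw [← cancel_mono ((F.commShiftIso n).app Y).inv]
  simpa using h

end IsCoveringFunctor

variable [HasZeroObject T] [∀ n : ℤ, (shiftFunctor T n).Additive] [Pretriangulated T]
  [HasZeroObject U] [∀ n : ℤ, (shiftFunctor U n).Additive] [Pretriangulated U]
  [F.CommShift ℤ]

lemma IsCoveringFunctor.generates_preimage [F.Additive] (hcov : IsCoveringFunctor F) {B : Set U}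
    (hB : B ⊆ Set.range F.obj) (hgen : GeneratesTriang U B) : GeneratesTriang T (F.obj ⁻¹' B) := by
  intro P hP hBP X
  have hX := hgen _ (isThickSet_effaceableSet F P) (by
    intro V hV
    obtain ⟨Y, rfl⟩ := hB hV
    exact hcov.effaceable_of_mem hP (fun Y' h ↦ hBP (by simpa [h] using hV))) (F.obj X)
  obtain ⟨Z, s, hs, h⟩ := hX 0 ((shiftFunctorZero U ℤ).inv.app (F.obj X))
  have hs₀ : s = 0 := hcov.map_injective (by
    rw [F.map_zero, ← cancel_mono ((shiftFunctorZero U ℤ).inv.app (F.obj X)), zero_comp]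
    exact h)
  exact hP.mem_of_factorsThroughSet_id
    (hs _ (by simpa [hs₀] using hP.factorsThroughSet_zero Z X))

lemma IsThickSet.preimage [F.IsTriangulated] {P : Set U} (hP : IsThickSet U P) :
    IsThickSet T (F.obj ⁻¹' P) :=
  ⟨fun _ _ e hX ↦ hP.1 (F.mapIso e) hX, hP.1 F.mapZeroObject.symm hP.2.1,
    fun X n hX ↦ hP.1 ((F.commShiftIso n).app X).symm (hP.2.2.1 _ n hX),
    fun _ hA h₁ h₃ ↦ hP.2.2.2.1 _ (F.map_distinguished _ hA) h₁ h₃,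
    fun _ _ ⟨i, r, h⟩ hY ↦ hP.2.2.2.2 _ _ ⟨F.map i, F.map r, by rw [← F.map_comp, h, F.map_id]⟩ hY⟩

lemma GeneratesTriang.of_preimage [F.IsTriangulated] {B : Set U}
    (hgen : GeneratesTriang U (Set.range F.obj)) (h : GeneratesTriang T (F.obj ⁻¹' B)) :
    GeneratesTriang U B := by
  intro P hP hBP
  refine hgen P hP ?_
  rintro _ ⟨X, rfl⟩
  exact h _ hP.preimage (fun Y hY ↦ hBP hY) X

end Tilting

theorem tilting_iff_preimage_tilting
    {T : Type*} [Category T] [Preadditive T] [HasZeroObject T] [HasShift T ℤ]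
    [∀ n : ℤ, (shiftFunctor T n).Additive] [Pretriangulated T]
    [IsIdempotentComplete T]
    {U : Type*} [Category U] [Preadditive U] [HasZeroObject U] [HasShift U ℤ]
    [∀ n : ℤ, (shiftFunctor U n).Additive] [Pretriangulated U]
    [IsIdempotentComplete U]
    (F : T ⥤ U) [F.Additive] [F.CommShift ℤ] [F.IsTriangulated]
    (hcov : IsCoveringFunctor F)
    (hgen : GeneratesTriang U (Set.range F.obj))
    (B : Set U) (hB : ∀ Y ∈ B, ∃ X : T, F.obj X = Y) :
    IsTiltingSet U B ↔ IsTiltingSet T (F.obj ⁻¹' B) := by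
  exact ⟨fun h ↦ ⟨hcov.isPretiltingSet_preimage h.1, hcov.generates_preimage hB h.2⟩,
    fun h ↦ ⟨hcov.isPretiltingSet_of_preimage hB h.1, .of_preimage hgen h.2⟩⟩
end
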